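/- The locally Menger-bounded property is hereditary: if (X, 𝓤) is a locally Menger-bounded uniform space and Y ⊆ X, then the subspace (Y, 𝓤_Y) with the relative uniformity is locally Menger-bounded. -/

import Mathlib

open UniformSpace Set Filter Uniformity

def MengerBounded (X : Type*) [UniformSpace X] : Prop :=
  ∀ U : ℕ → Set (X × X), (∀ n, U n ∈ 𝓤 X) →
    ∃ F : ℕ → Finset X, ∀ x : X, ∃ n : ℕ, ∃ y ∈ F n, x ∈ UniformSpace.ball y (U n)

def LocallyMengerBounded (X : Type*) [UniformSpace X] : Prop :=
  ∀ x : X, ∃ U ∈ 𝓤 X, MengerBounded ↥(UniformSpace.ball x U)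

theorem MengerBounded.of_isUniformInducing {A B : Type*} [UniformSpace A] [UniformSpace B]
    {f : A → B} (hf : IsUniformInducing f) (hB : MengerBounded B) : MengerBounded A := by
  classical
  intro U hU
  rcases isEmpty_or_nonempty A with hA | hA
  · exact ⟨fun _ => ∅, fun x => hA.elim x⟩
  have hV : ∀ n, ∃ V ∈ 𝓤 B, ∀ a a' : A, (f a, f a') ∈ V → (a, a') ∈ U n := by
    intro n
    have h := hU n
    rw [← hf.comap_uniformity, Filter.mem_comap] at h
    obtain ⟨V, hV, hVU⟩ := h
    exact ⟨V, hV, fun a a' h => hVU h⟩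
  choose V hV hVU using hV
  have hW : ∀ n, ∃ W ∈ 𝓤 B, ∀ y b c : B, (y, b) ∈ W → (y, c) ∈ W → (b, c) ∈ V n := by
    intro n
    obtain ⟨W, hW, hsymm, hWV⟩ := comp_symm_mem_uniformity_sets (hV n)
    exact ⟨W, hW, fun y b c hb hc => hWV ⟨y, hsymm.symm _ _ hb, hc⟩⟩
  choose W hW hWV using hW
  obtain ⟨F, hF⟩ := hB W hW
  refine ⟨fun n => (F n).image fun y => Classical.epsilon fun a => (y, f a) ∈ W n, fun x => ?_⟩
  obtain ⟨n, y, hy, hxy⟩ := hF (f x)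
  exact ⟨n, _, Finset.mem_image_of_mem _ hy, hVU n _ _
    (hWV n y _ _ (Classical.epsilon_spec (p := fun a => (y, f a) ∈ W n) ⟨x, hxy⟩) hxy)⟩

theorem stmt_14 {X : Type*} [UniformSpace X] (hX : LocallyMengerBounded X)
    (Y : Set X) : LocallyMengerBounded ↥Y := by
  intro x
  obtain ⟨U, hU, hM⟩ := hX x
  refine ⟨Prod.map Subtype.val Subtype.val ⁻¹' U,
    uniformContinuous_subtype_val hU, ?_⟩
  let f : ↥(UniformSpace.ball x (Prod.map Subtype.val Subtype.val ⁻¹' U)) →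
    ↥(UniformSpace.ball (x : X) U) := fun z => ⟨z.1.1, z.2⟩
  refine MengerBounded.of_isUniformInducing (f := f) ⟨?_⟩ hM
  simp only [uniformity_subtype, Filter.comap_comap]
  rfl
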